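/- Spectral gap for two-fold degenerate flat bands: Let U₊, U₋ be smooth potentials with the symmetries described below, and let α ∈ ℂ be magic, i.e. Ker(α,k) ≠ {0} for every k ∈ ℂ. Then the following are equivalent: (i) dim_ℂ Ker(α,k) = 2 for every k ∈ ℂ; (ii) there exists p ∈ ℂ with dim_ℂ Ker(α,p) = 2. (In particular, if at one quasi-momentum the kernel is exactly two-dimensional, the four-fold degenerate flat band is gapped from the rest of the spectrum: the kernel is exactly two-dimensional at every quasi-momentum.) -/

import Mathlib

noncomputable section

open Complex MeasureTheory

namespace TBG

/-- `ω = exp(2πi/3)`. -/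
def ω : ℂ := Complex.exp (2 * Real.pi * Complex.I / 3)

/-- The moiré lattice `Λ = ℤω + ℤ ⊂ ℂ`. -/
def Λ : Set ℂ := {z : ℂ | ∃ m n : ℤ, z = m * ω + n}

/-- The dual lattice `Λ* = (4πi/√3)·Λ`. -/
def Λdual : Set ℂ := {p : ℂ | ∃ m n : ℤ, p = 4 * Real.pi * Complex.I / Real.sqrt 3 * (m * ω + n)}

/-- The high symmetry point `K = 4π/3`. -/
def K : ℂ := 4 * Real.pi / 3

/-- `⟨z,w⟩ = Re (z · conj w)`. -/
def pair (z w : ℂ) : ℝ := (z * (starRingEnd ℂ) w).re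

/-- `2 D_z̄ f = (1/i)(∂_x f + i ∂_y f)`. -/
def Dbar (f : ℂ → ℂ) (z : ℂ) : ℂ :=
  1 / Complex.I * (fderiv ℝ f z 1 + Complex.I * fderiv ℝ f z Complex.I)

/-- A tunnelling potential: smooth, with the translational and rotational symmetries. -/
def IsTunnelling (U : ℂ → ℂ) : Prop :=
  ContDiff ℝ (⊤ : ℕ∞) U ∧
    (∀ γ ∈ Λ, ∀ z : ℂ, U (z + γ) = Complex.exp (Complex.I * (pair γ K : ℂ)) * U z) ∧
    ∀ z : ℂ, U (ω * z) = ω * U z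

/-- Membership in `ker_{L²₀}(D(α)+k)` for the chiral model with tunnelling
potentials `U₊ = Up`, `U₋ = Um`: smooth solutions of `(D(α)+k)u = 0` with the
Floquet boundary conditions. -/
def InKer (Up Um : ℂ → ℂ) (α k : ℂ) (u : ℂ → ℂ × ℂ) : Prop :=
  ContDiff ℝ (⊤ : ℕ∞) u ∧
    (∀ z : ℂ, Dbar (fun w => (u w).1) z + k * (u z).1 + α * Up z * (u z).2 = 0) ∧
    (∀ z : ℂ, Dbar (fun w => (u w).2) z + k * (u z).2 + α * Um z * (u z).1 = 0) ∧
    (∀ γ ∈ Λ, ∀ z : ℂ, (u (z + γ)).1 = Complex.exp (-Complex.I * (pair γ K : ℂ)) * (u z).1) ∧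
    (∀ γ ∈ Λ, ∀ z : ℂ, (u (z + γ)).2 = Complex.exp (Complex.I * (pair γ K : ℂ)) * (u z).2)

/-- `Ker(α,k)` as a set of functions. -/
def kerSet (Up Um : ℂ → ℂ) (α k : ℂ) : Set (ℂ → ℂ × ℂ) := {u | InKer Up Um α k u}

/-- `dim_ℂ Ker(α,k)` (the set `Ker(α,k)` is a linear subspace, so the finrank of its span
is its dimension). -/
def kerDim (Up Um : ℂ → ℂ) (α k : ℂ) : ℕ :=
  Module.finrank ℂ ↥(Submodule.span ℂ (kerSet Up Um α k))

/-- `Ker_p(α) = {u ∈ Ker(α,0) : u(ωz) = ω^(−p)·u(z)}`. -/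
def kerPSet (Up Um : ℂ → ℂ) (α : ℂ) (p : ℕ) : Set (ℂ → ℂ × ℂ) :=
  {u | u ∈ kerSet Up Um α 0 ∧ ∀ z : ℂ, u (ω * z) = (ω ^ (-(p : ℤ))) • u z}

/-- `dim_ℂ Ker_p(α)`. -/
def kerPDim (Up Um : ℂ → ℂ) (α : ℂ) (p : ℕ) : ℕ :=
  Module.finrank ℂ ↥(Submodule.span ℂ (kerPSet Up Um α p))

/-- `α` is magic: the flat band condition `Ker(α,k) ≠ {0}` for every `k`. -/
def IsMagic (Up Um : ℂ → ℂ) (α : ℂ) : Prop :=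
  ∀ k : ℂ, ∃ u ∈ kerSet Up Um α k, u ≠ 0

/-- `∂_z f`. -/
def dz (f : ℂ → ℂ) (z : ℂ) : ℂ :=
  1 / 2 * (fderiv ℝ f z 1 - Complex.I * fderiv ℝ f z Complex.I)

/-- Infinite differentiability in the real sense. -/
abbrev Smooth (f : ℂ → ℂ) : Prop := ContDiff ℝ (⊤ : ℕ∞) f

lemma fderiv_eq_dz_Dbar (f : ℂ → ℂ) (z : ℂ) :
    fderiv ℝ f z = dz f z • (ContinuousLinearMap.id ℝ ℂ) +
      (I / 2 * Dbar f z) • (conjCLE : ℂ →L[ℝ] ℂ) := by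
  ext v
  have hv : v = v.re • (1 : ℂ) + v.im • I := by
    simp
  simp only [dz, Dbar]
  conv_lhs => rw [hv, map_add, map_smul, map_smul]
  simp only [add_apply, smul_apply,
    ContinuousLinearMap.id_apply, ContinuousLinearEquiv.coe_coe, conjCLE_apply, smul_eq_mul,
    real_smul]
  conv_rhs => rw [← re_add_im v]
  simp only [map_add, map_mul, conj_ofReal, conj_I]
  have : I * I = -1 := I_mul_I
  field_simp
  ring_nf
  simp only [I_sq]
  ring

lemma dz_Dbar_of_hasFDerivAt {f : ℂ → ℂ} {z a b : ℂ}
    (h : HasFDerivAt f (a • (ContinuousLinearMap.id ℝ ℂ) +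
      (I / 2 * b) • (conjCLE : ℂ →L[ℝ] ℂ)) z) : dz f z = a ∧ Dbar f z = b := by
  have : I * I = -1 := I_mul_I
  simp only [dz, Dbar, h.fderiv]
  simp
  constructor
  · linear_combination (-1/2 * a + 1/4 * I * b) * this
  · linear_combination (-b - I * a + b / 2 * I ^ 2) * this

lemma Smooth.differentiable {f : ℂ → ℂ} (hf : Smooth f) : Differentiable ℝ f :=
  ContDiff.differentiable hf (by simp)

lemma hasFDerivAt_dz_Dbar {f : ℂ → ℂ} (hf : Differentiable ℝ f) (z : ℂ) :
    HasFDerivAt f (dz f z • (ContinuousLinearMap.id ℝ ℂ) +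
      (I / 2 * Dbar f z) • (conjCLE : ℂ →L[ℝ] ℂ)) z := by
  rw [← fderiv_eq_dz_Dbar]
  exact (hf z).hasFDerivAt

lemma Smooth.fderiv_apply {f : ℂ → ℂ} (hf : Smooth f) (v : ℂ) :
    Smooth (fun z => fderiv ℝ f z v) :=
  (hf.fderiv_right (m := (⊤ : ℕ∞)) (by simp)).clm_apply contDiff_const

lemma Smooth.dz {f : ℂ → ℂ} (hf : Smooth f) : Smooth (dz f) :=
  contDiff_const.mul ((hf.fderiv_apply 1).sub (contDiff_const.mul (hf.fderiv_apply I)))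

lemma Smooth.Dbar {f : ℂ → ℂ} (hf : Smooth f) : Smooth (Dbar f) :=
  contDiff_const.mul ((hf.fderiv_apply 1).add (contDiff_const.mul (hf.fderiv_apply I)))

lemma Smooth.fderiv_fderiv_apply {f : ℂ → ℂ} (hf : Smooth f) (z v w : ℂ) :
    fderiv ℝ (fun z => fderiv ℝ f z v) z w = fderiv ℝ (fderiv ℝ f) z w v := by
  have : DifferentiableAt ℝ (fderiv ℝ f) z :=
    ((hf.fderiv_right (m := (⊤ : ℕ∞)) (by simp)).differentiable (by simp)) z
  rw [fderiv_clm_apply this (by fun_prop)]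
  simp

lemma Smooth.dz_Dbar_comm {f : ℂ → ℂ} (hf : Smooth f) :
    TBG.dz (TBG.Dbar f) = TBG.Dbar (TBG.dz f) := by
  have h1 := (hf.fderiv_apply 1).differentiable
  have h2 := (hf.fderiv_apply I).differentiable
  ext z
  have hs : fderiv ℝ (fderiv ℝ f) z 1 I = fderiv ℝ (fderiv ℝ f) z I 1 :=
    (hf.contDiffAt.isSymmSndFDerivAt (by simpa using WithTop.coe_le_coe.2 (le_top : (2 : ℕ∞) ≤ ⊤))) 1 I
  have e1 : fderiv ℝ (TBG.Dbar f) z = (1 / I) • (fderiv ℝ (fun z => fderiv ℝ f z 1) z +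
      I • fderiv ℝ (fun z => fderiv ℝ f z I) z) :=
    (((h1 z).hasFDerivAt.add ((h2 z).hasFDerivAt.const_mul I)).const_mul (1 / I)).fderiv
  have e2 : fderiv ℝ (TBG.dz f) z = (1 / 2 : ℂ) • (fderiv ℝ (fun z => fderiv ℝ f z 1) z -
      I • fderiv ℝ (fun z => fderiv ℝ f z I) z) :=
    (((h1 z).hasFDerivAt.sub ((h2 z).hasFDerivAt.const_mul I)).const_mul (1 / 2 : ℂ)).fderiv
  rw [TBG.dz, TBG.Dbar, e1, e2]
  simp only [smul_apply, add_apply,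
    sub_apply, hf.fderiv_fderiv_apply, hs, smul_eq_mul]
  ring

lemma Dbar_mul {f g : ℂ → ℂ} (hf : Differentiable ℝ f) (hg : Differentiable ℝ g) (z : ℂ) :
    Dbar (fun w => f w * g w) z = Dbar f z * g z + f z * Dbar g z := by
  simp only [Dbar, fderiv_fun_mul (hf z) (hg z)]
  simp
  ring

lemma dz_mul {f g : ℂ → ℂ} (hf : Differentiable ℝ f) (hg : Differentiable ℝ g) (z : ℂ) :
    dz (fun w => f w * g w) z = dz f z * g z + f z * dz g z := by
  simp only [dz, fderiv_fun_mul (hf z) (hg z)]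
  simp
  ring

lemma Dbar_add {f g : ℂ → ℂ} (hf : Differentiable ℝ f) (hg : Differentiable ℝ g) (z : ℂ) :
    Dbar (fun w => f w + g w) z = Dbar f z + Dbar g z := by
  simp only [Dbar, fderiv_fun_add (hf z) (hg z)]
  simp
  ring

lemma Dbar_sub {f g : ℂ → ℂ} (hf : Differentiable ℝ f) (hg : Differentiable ℝ g) (z : ℂ) :
    Dbar (fun w => f w - g w) z = Dbar f z - Dbar g z := by
  simp only [Dbar, fderiv_fun_sub (hf z) (hg z)]
  simp
  ring

lemma dz_sub {f g : ℂ → ℂ} (hf : Differentiable ℝ f) (hg : Differentiable ℝ g) (z : ℂ) :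
    dz (fun w => f w - g w) z = dz f z - dz g z := by
  simp only [dz, fderiv_fun_sub (hf z) (hg z)]
  simp
  ring

lemma dz_Dbar_of_hasDerivAt {f : ℂ → ℂ} {z a : ℂ} (h : HasDerivAt f a z) :
    dz f z = a ∧ Dbar f z = 0 := by
  refine dz_Dbar_of_hasFDerivAt (b := 0) ?_
  have h' := h.hasFDerivAt.restrictScalars ℝ
  have e : a • ContinuousLinearMap.id ℝ ℂ + (I / 2 * 0) • (conjCLE : ℂ →L[ℝ] ℂ) =
      (ContinuousLinearMap.toSpanSingleton ℂ a).restrictScalars ℝ := by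
    ext v
    simp [mul_comm]
  rw [e]
  exact h'

lemma Dbar_holo {f : ℂ → ℂ} (hf : Differentiable ℂ f) (z : ℂ) : Dbar f z = 0 :=
  (dz_Dbar_of_hasDerivAt (hf z).hasDerivAt).2

lemma dz_const_mul {f : ℂ → ℂ} (hf : Differentiable ℝ f) (c z : ℂ) :
    dz (fun w => c * f w) z = c * dz f z := by
  rw [dz_mul (by fun_prop) hf, (dz_Dbar_of_hasDerivAt (hasDerivAt_const z c)).1]; ring

lemma Dbar_const_mul {f : ℂ → ℂ} (hf : Differentiable ℝ f) (c z : ℂ) :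
    Dbar (fun w => c * f w) z = c * Dbar f z := by
  rw [Dbar_mul (by fun_prop) hf, (dz_Dbar_of_hasDerivAt (hasDerivAt_const z c)).2]; ring

/-- Smooth `f` all of whose derivatives `∂_z^j ∂_z̄^k f`, `j < m`, vanish at the origin. -/
structure FlatDbar (m : ℕ) (f : ℂ → ℂ) : Prop where
  smooth : Smooth f
  iter_eq_zero : ∀ j < m, ∀ k, dz^[j] (Dbar^[k] f) 0 = 0

lemma Smooth.iterate_dz {f : ℂ → ℂ} (hf : Smooth f) (j : ℕ) : Smooth (TBG.dz^[j] f) := by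
  induction j with
  | zero => exact hf
  | succ j ih => rw [Function.iterate_succ_apply']; exact ih.dz

lemma Smooth.iterate_Dbar {f : ℂ → ℂ} (hf : Smooth f) (j : ℕ) : Smooth (TBG.Dbar^[j] f) := by
  induction j with
  | zero => exact hf
  | succ j ih => rw [Function.iterate_succ_apply']; exact ih.Dbar

lemma Smooth.iterate_Dbar_dz {f : ℂ → ℂ} (hf : Smooth f) (k : ℕ) :
    TBG.Dbar^[k] (TBG.dz f) = TBG.dz (TBG.Dbar^[k] f) := by
  induction k with
  | zero => rfl
  | succ k ih =>
    rw [Function.iterate_succ_apply', ih, Function.iterate_succ_apply',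
      (hf.iterate_Dbar k).dz_Dbar_comm]

lemma FlatDbar.dbar {m : ℕ} {f : ℂ → ℂ} (hf : FlatDbar m f) : FlatDbar m (Dbar f) :=
  ⟨hf.smooth.Dbar, fun j hj k => hf.iter_eq_zero j hj (k + 1)⟩

lemma FlatDbar.dz {m : ℕ} {f : ℂ → ℂ} (hf : FlatDbar (m + 1) f) : FlatDbar m (dz f) := by
  refine ⟨hf.smooth.dz, fun j hj k => ?_⟩
  rw [hf.smooth.iterate_Dbar_dz, ← Function.iterate_succ_apply]
  exact hf.iter_eq_zero (j + 1) (by lia) k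

lemma FlatDbar.mono {m n : ℕ} {f : ℂ → ℂ} (hf : FlatDbar m f) (h : n ≤ m) : FlatDbar n f :=
  ⟨hf.smooth, fun j hj k => hf.iter_eq_zero j (by lia) k⟩

lemma iterate_Dbar_euler {f : ℂ → ℂ} (hf : Smooth f) (c : ℂ) (k : ℕ) :
    Dbar^[k] (fun z => z * dz f z - c * f z) =
      fun z => z * dz (Dbar^[k] f) z - c * Dbar^[k] f z := by
  induction k with
  | zero => rfl
  | succ k ih =>
    have hg := hf.iterate_Dbar k
    rw [Function.iterate_succ_apply', ih, Function.iterate_succ_apply']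
    ext z
    rw [Dbar_sub (by have := hg.dz.differentiable; fun_prop)
      (by have := hg.differentiable; fun_prop), Dbar_const_mul hg.differentiable,
      Dbar_mul (by fun_prop) hg.dz.differentiable, Dbar_holo (by fun_prop), ← hg.dz_Dbar_comm]
    ring

lemma iterate_dz_euler {f : ℂ → ℂ} (hf : Smooth f) (c : ℂ) (j : ℕ) :
    dz^[j] (fun z => z * dz f z - c * f z) =
      fun z => z * dz (dz^[j] f) z - (c - j) * dz^[j] f z := by
  induction j with
  | zero => simp
  | succ j ih =>
    have hg := hf.iterate_dz j
    rw [Function.iterate_succ_apply', ih, Function.iterate_succ_apply']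
    ext z
    rw [dz_sub (by have := hg.dz.differentiable; fun_prop)
      (by have := hg.differentiable; fun_prop), dz_const_mul hg.differentiable,
      dz_mul (by fun_prop) hg.dz.differentiable,
      (dz_Dbar_of_hasDerivAt (hasDerivAt_id' z)).1]
    push_cast
    ring

lemma FlatDbar.euler {m : ℕ} {f : ℂ → ℂ} (hf : FlatDbar m f) :
    FlatDbar (m + 1) (fun z => z * TBG.dz f z - m * f z) := by
  refine ⟨(contDiff_id.mul hf.smooth.dz).sub (contDiff_const.mul hf.smooth), fun j hj k => ?_⟩
  rw [iterate_Dbar_euler hf.smooth, iterate_dz_euler (hf.smooth.iterate_Dbar k)]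
  rcases Nat.lt_succ_iff_lt_or_eq.1 hj with h | rfl
  · simp [hf.iter_eq_zero j h k]
  · simp

open Filter Topology Asymptotics in
lemma FlatDbar.isLittleO {m : ℕ} : ∀ {f : ℂ → ℂ}, FlatDbar m f →
    (fun z => f z - TBG.dz^[m] f 0 / (m.factorial : ℂ) * z ^ m) =o[𝓝 0] fun z => z ^ m := by
  induction m with
  | zero =>
    intro f hf
    have h := hf.smooth.continuous.tendsto 0
    simpa [isLittleO_one_iff, ← tendsto_sub_nhds_zero_iff] using h
  | succ m ih =>
    intro f hf
    set c := TBG.dz^[m + 1] f 0 / ((m + 1).factorial : ℂ) with hc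
    have h1 := ih hf.dz
    have h2 := ih (hf.dbar.mono (Nat.le_succ m))
    have h0 : TBG.dz^[m] (Dbar f) 0 = 0 := hf.iter_eq_zero m (by lia) 1
    simp only [h0, zero_div, zero_mul, sub_zero] at h2
    have hd : ∀ z, HasFDerivAt (fun z => f z - c * z ^ (m + 1))
        ((TBG.dz f z - c * ((m + 1) * z ^ m)) • (ContinuousLinearMap.id ℝ ℂ) +
      (I / 2 * Dbar f z) • (conjCLE : ℂ →L[ℝ] ℂ)) z := by
      intro z
      have hp : HasDerivAt (fun z : ℂ => c * z ^ (m + 1)) (c * ((m + 1) * z ^ m)) z := by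
        simpa using (hasDerivAt_pow (m + 1) z).const_mul c
      have := (hasFDerivAt_dz_Dbar hf.smooth.differentiable z).sub
        (hp.hasFDerivAt.restrictScalars ℝ)
      refine this.congr_fderiv ?_
      ext v
      simp
      ring
    have hcm : TBG.dz^[m] (TBG.dz f) 0 / (m.factorial : ℂ) = c * (m + 1) := by
      rw [hc, Nat.factorial_succ, Function.iterate_succ_apply]
      have : (m.factorial : ℂ) ≠ 0 := by exact_mod_cast m.factorial_ne_zero
      have : (m + 1 : ℂ) ≠ 0 := by exact_mod_cast m.succ_ne_zero
      push_cast
      field_simp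
    rw [hcm] at h1
    rw [isLittleO_iff] at h1 h2 ⊢
    intro ε hε
    have e1 := h1 (half_pos hε)
    have e2 := h2 hε
    obtain ⟨δ, hδ, hb⟩ := Metric.eventually_nhds_iff_ball.1 (e1.and e2)
    refine Metric.eventually_nhds_iff_ball.2 ⟨δ, hδ, fun z hz => ?_⟩
    have hsub : ∀ x ∈ Metric.closedBall (0 : ℂ) ‖z‖, ‖(TBG.dz f x - c * ((m + 1) * x ^ m)) •
        (ContinuousLinearMap.id ℝ ℂ) + (I / 2 * Dbar f x) • (conjCLE : ℂ →L[ℝ] ℂ)‖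
          ≤ ε * ‖z‖ ^ m := by
      intro x hx
      have hxz : ‖x‖ ≤ ‖z‖ := by simpa using hx
      obtain ⟨b1, b2⟩ := hb x (by
        simp only [Metric.mem_ball, dist_zero_right] at hz ⊢; exact hxz.trans_lt hz)
      have hpow : ‖x‖ ^ m ≤ ‖z‖ ^ m := pow_le_pow_left₀ (norm_nonneg _) hxz m
      rw [norm_pow] at b1 b2
      refine ContinuousLinearMap.opNorm_le_bound _ (by positivity) fun v => ?_
      calc ‖((TBG.dz f x - c * ((m + 1) * x ^ m)) •
        (ContinuousLinearMap.id ℝ ℂ) + (I / 2 * Dbar f x) • (conjCLE : ℂ →L[ℝ] ℂ)) v‖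
          ≤ ‖TBG.dz f x - c * (m + 1) * x ^ m‖ * ‖v‖ + 1 / 2 * ‖Dbar f x‖ * ‖v‖ := by
            refine (norm_add_le _ _).trans (le_of_eq ?_)
            simp [mul_assoc]
        _ ≤ (ε / 2 * ‖z‖ ^ m) * ‖v‖ + 1 / 2 * (ε * ‖z‖ ^ m) * ‖v‖ := by
            gcongr
            · exact b1.trans (by gcongr)
            · exact b2.trans (by gcongr)
        _ = ε * ‖z‖ ^ m * ‖v‖ := by ring
    have hmv := (convex_closedBall (0 : ℂ) ‖z‖).norm_image_sub_le_of_norm_hasFDerivWithin_le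
      (fun x _ => (hd x).hasFDerivWithinAt) hsub (x := 0) (y := z) (by simp) (by simp)
    have hf0 : f 0 = 0 := hf.iter_eq_zero 0 (by lia) 0
    simpa [hf0, pow_succ, mul_assoc] using hmv

/-- The continuous extension of `f / z ^ m`. -/
def quo (m : ℕ) (f : ℂ → ℂ) (z : ℂ) : ℂ :=
  if z = 0 then dz^[m] f 0 / (m.factorial : ℂ) else f z / z ^ m

open Filter Topology Asymptotics in
lemma FlatDbar.continuous_quo {m : ℕ} {f : ℂ → ℂ} (hf : FlatDbar m f) : Continuous (quo m f) := by
  rw [continuous_iff_continuousAt]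
  intro z
  by_cases hz : z = 0
  · subst hz
    rw [continuousAt_iff_punctured_nhds, ← tendsto_sub_nhds_zero_iff]
    refine (((hf.isLittleO.tendsto_div_nhds_zero)).mono_left nhdsWithin_le_nhds).congr' ?_
    filter_upwards [self_mem_nhdsWithin] with x hx
    have hx : x ≠ 0 := hx
    simp only [quo, hx, if_false, if_true]
    field_simp
  · have : quo m f =ᶠ[𝓝 z] fun z => f z / z ^ m := by
      filter_upwards [isOpen_ne.mem_nhds hz] with x hx
      simp [quo, hx]
    rw [continuousAt_congr this]
    exact hf.smooth.continuous.continuousAt.div (by fun_prop) (pow_ne_zero _ hz)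

/-- The derivative of `quo m f`. -/
def quoDeriv (m : ℕ) (f : ℂ → ℂ) (z : ℂ) : ℂ →L[ℝ] ℂ :=
  quo (m + 1) (fun z => z * dz f z - m * f z) z • (ContinuousLinearMap.id ℝ ℂ) +
      (I / 2 * quo m (Dbar f) z) • (conjCLE : ℂ →L[ℝ] ℂ)

lemma FlatDbar.hasFDerivAt_quo_of_ne {m : ℕ} {f : ℂ → ℂ} (hf : FlatDbar m f) {z : ℂ}
    (hz : z ≠ 0) : HasFDerivAt (quo m f) (quoDeriv m f z) z := by
  have hp : HasDerivAt (fun z : ℂ => (z ^ m)⁻¹) (-(m * z ^ (m - 1)) / (z ^ m) ^ 2) z :=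
    (hasDerivAt_pow m z).inv (pow_ne_zero _ hz)
  have := (hasFDerivAt_dz_Dbar hf.smooth.differentiable z).mul (hp.hasFDerivAt.restrictScalars ℝ)
  refine (this.congr_of_eventuallyEq (f₁ := quo m f) ?_).congr_fderiv ?_
  · filter_upwards [isOpen_ne.mem_nhds hz] with x hx
    have hx : x ≠ 0 := hx
    simp [quo, hx, div_eq_mul_inv]
  · ext v
    simp [quoDeriv, quo, hz]
    rcases m with _ | m
    · simp
      field_simp
      exact Or.inl trivial
    · simp
      field_simp
      ring

open Filter Topology in
lemma FlatDbar.hasFDerivAt_quo {m : ℕ} {f : ℂ → ℂ} (hf : FlatDbar m f) (z : ℂ) :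
    HasFDerivAt (quo m f) (quoDeriv m f z) z := by
  by_cases hz : z = 0
  swap
  · exact hf.hasFDerivAt_quo_of_ne hz
  subst hz
  have hc : Continuous (quoDeriv m f) :=
    (hf.euler.continuous_quo.smul continuous_const).add
      ((continuous_const.mul hf.dbar.continuous_quo).smul continuous_const)
  have key : ∀ s : Set ℂ, IsOpen s → Convex ℝ s → (0 : ℂ) ∉ s →
      HasFDerivWithinAt (quo m f) (quoDeriv m f 0) (closure s) 0 := by
    intro s hs hconv h0
    have hne : ∀ x ∈ s, x ≠ 0 := fun x hx h => h0 (h ▸ hx)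
    refine hasFDerivWithinAt_closure_of_tendsto_fderiv
      (fun x hx => (hf.hasFDerivAt_quo_of_ne (hne x hx)).differentiableAt.differentiableWithinAt)
      hconv hs (fun y _ => hf.continuous_quo.continuousWithinAt) ?_
    refine ((hc.tendsto 0).mono_left nhdsWithin_le_nhds).congr' ?_
    filter_upwards [self_mem_nhdsWithin] with x hx
    exact (hf.hasFDerivAt_quo_of_ne (hne x hx)).fderiv.symm
  have h1 := key {z | 0 < z.im} (isOpen_lt continuous_const continuous_im)
    (convex_halfSpace_im_gt 0) (by simp)
  have h2 := key {z | z.im < 0} (isOpen_lt continuous_im continuous_const)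
    (convex_halfSpace_im_lt 0) (by simp)
  have h := h1.union h2
  rwa [closure_setOfPred_lt_im, closure_setOfPred_im_lt, show
    {z : ℂ | 0 ≤ z.im} ∪ {z | z.im ≤ 0} = Set.univ from
      Set.eq_univ_of_forall fun x => le_total 0 x.im, hasFDerivWithinAt_univ] at h

lemma FlatDbar.contDiff_quo (n : ℕ) : ∀ {m : ℕ} {f : ℂ → ℂ}, FlatDbar m f →
    ContDiff ℝ n (quo m f) := by
  induction n with
  | zero => intro m f hf; exact contDiff_zero.2 hf.continuous_quo
  | succ n ih =>
    intro m f hf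
    refine contDiff_succ_iff_hasFDerivAt.2 ⟨quoDeriv m f, ?_, hf.hasFDerivAt_quo⟩
    exact ((ih hf.euler).smul contDiff_const).add
      ((contDiff_const.mul (ih hf.dbar)).smul contDiff_const)

lemma Dbar_comp_add (f : ℂ → ℂ) (a : ℂ) : Dbar (fun z => f (z + a)) = fun z => Dbar f (z + a) := by
  ext z
  simp only [Dbar, fderiv_comp_add_right]

/-- A smooth function whose `z̄`-derivatives of all orders vanish at `a` is divisible by `z - a`. -/
lemma Smooth.exists_eq_sub_mul {f : ℂ → ℂ} (hf : Smooth f) (a : ℂ)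
    (h : ∀ k, TBG.Dbar^[k] f a = 0) : ∃ g, Smooth g ∧ ∀ z, f z = (z - a) * g z := by
  have hit : ∀ k, TBG.Dbar^[k] (fun z => f (z + a)) = fun z => TBG.Dbar^[k] f (z + a) := by
    intro k
    induction k with
    | zero => rfl
    | succ k ih => rw [Function.iterate_succ_apply', ih, Function.iterate_succ_apply',
        Dbar_comp_add]
  have hF : FlatDbar 1 (fun z => f (z + a)) := by
    refine ⟨hf.comp (contDiff_id.add contDiff_const), fun j hj k => ?_⟩
    obtain rfl : j = 0 := by lia
    simp [hit, h]
  refine ⟨fun z => quo 1 (fun z => f (z + a)) (z - a), ?_, fun z => ?_⟩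
  · exact (contDiff_infty.2 fun n => hF.contDiff_quo n).comp (contDiff_id.sub contDiff_const)
  · by_cases hz : z = a
    · simpa [hz] using h 0
    · have : z - a ≠ 0 := sub_ne_zero.2 hz
      simp [quo, this]
      field_simp

lemma ω_im_pos : 0 < ω.im := by
  have : (2 * Real.pi * Complex.I / 3 : ℂ) = ((2 * Real.pi / 3 : ℝ) : ℂ) * I := by
    push_cast; ring
  rw [ω, this, exp_ofReal_mul_I_im]
  exact Real.sin_pos_of_pos_of_lt_pi (by positivity) (by linarith [Real.pi_pos])

/-- The nome `exp(2πiω)`. -/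
def nome : ℂ := cexp (2 * Real.pi * I * ω)

lemma norm_nome_lt_one : ‖nome‖ < 1 := by
  rw [nome, norm_exp, Real.exp_lt_one_iff]
  have := mul_pos Real.pi_pos ω_im_pos
  simp
  linarith

lemma nome_ne_zero : nome ≠ 0 := exp_ne_zero _

/-- The `q`-Pochhammer symbol `(w; q)_∞` for the nome `q`. -/
def qPoch (w : ℂ) : ℂ := ∏' n : ℕ, (1 + -(nome ^ n * w))

lemma summable_nome_mul (w : ℂ) : Summable fun n : ℕ => ‖-(nome ^ n * w)‖ := by
  simp only [norm_neg, norm_mul, norm_pow]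
  exact (summable_geometric_of_lt_one (norm_nonneg _) norm_nome_lt_one).mul_right _

lemma differentiable_qPoch : Differentiable ℂ qPoch := by
  intro w
  set B := Metric.ball (0 : ℂ) (‖w‖ + 1)
  have hw : w ∈ B := by simp [B]
  have h := Summable.hasProdLocallyUniformlyOn_nat_one_add (f := fun n w => -(nome ^ n * w))
    (K := B) Metric.isOpen_ball
    ((summable_geometric_of_lt_one (norm_nonneg _) norm_nome_lt_one).mul_right (‖w‖ + 1))
    (.of_forall fun n x hx => by
      have : ‖x‖ < ‖w‖ + 1 := by simpa [B] using hx
      simp only [norm_neg, norm_mul, norm_pow]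
      gcongr) (fun n => by fun_prop)
  have hd := h.differentiableOn
    (.of_forall fun _ => by
      simpa [Finset.prod_fn] using DifferentiableOn.finsetProd (fun _ _ ↦ by fun_prop))
      Metric.isOpen_ball
  exact hd.differentiableAt (Metric.isOpen_ball.mem_nhds hw)

lemma qPoch_eq (w : ℂ) : qPoch w = (1 - w) * qPoch (nome * w) := by
  rw [qPoch, tprod_eq_zero_mul', qPoch]
  · simp [pow_succ, mul_assoc, sub_eq_add_neg]
  · simpa [pow_succ, mul_assoc] using multipliable_one_add_of_summable (summable_nome_mul (nome * w))

lemma exists_of_qPoch_eq_zero {w : ℂ} (h : qPoch w = 0) : ∃ n : ℕ, nome ^ n * w = 1 := by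
  by_contra! hn
  refine tprod_one_add_ne_zero_of_summable (f := fun n => -(nome ^ n * w)) (fun n hz => ?_)
    (summable_nome_mul w) h
  exact hn n (by linear_combination -hz)

lemma qPoch_nome_ne_zero : qPoch nome ≠ 0 := by
  intro h
  obtain ⟨n, hn⟩ := exists_of_qPoch_eq_zero h
  have h1 : ‖nome‖ ^ (n + 1) = 1 := by rw [← norm_pow, pow_succ, hn, norm_one]
  exact (pow_lt_one₀ (norm_nonneg _) norm_nome_lt_one n.succ_ne_zero).ne h1

/-- A theta function of the lattice `Λ`, with simple zeros exactly at the lattice points. -/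
def theta (z : ℂ) : ℂ :=
  qPoch (cexp (2 * Real.pi * I * z)) * qPoch (nome * cexp (-(2 * Real.pi * I * z)))

lemma differentiable_theta : Differentiable ℂ theta := by
  have := differentiable_qPoch
  unfold theta
  fun_prop

lemma theta_add_one (z : ℂ) : theta (z + 1) = theta z := by
  have h1 : cexp (2 * Real.pi * I * (z + 1)) = cexp (2 * Real.pi * I * z) := by
    rw [mul_add, exp_add, mul_one, exp_two_pi_mul_I, mul_one]
  rw [theta, theta, exp_neg, h1, exp_neg]

lemma theta_add_ω (z : ℂ) : theta (z + ω) = -cexp (-(2 * Real.pi * I * z)) * theta z := by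
  have h1 : cexp (2 * Real.pi * I * (z + ω)) = nome * cexp (2 * Real.pi * I * z) := by
    rw [mul_add, exp_add, nome, mul_comm]
  have hw := exp_ne_zero (2 * Real.pi * I * z)
  rw [theta, theta, exp_neg, h1, exp_neg]
  generalize cexp (2 * Real.pi * I * z) = w at *
  have hq := nome_ne_zero
  have h2 : nome * (nome * w)⁻¹ = w⁻¹ := by field_simp
  rw [h2, qPoch_eq w⁻¹, qPoch_eq w]
  field_simp
  ring

lemma mem_Λ_of_theta_eq_zero {z : ℂ} (h : theta z = 0) : z ∈ Λ := by
  have key : ∀ (n : ℤ) (s : ℂ), cexp (2 * Real.pi * I * (n * ω + s)) = 1 → ∃ m : ℤ, s = -n * ω + m := by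
    intro n s hs
    obtain ⟨m, hm⟩ := exp_eq_one_iff.1 hs
    refine ⟨m, ?_⟩
    have h0 := two_pi_I_ne_zero
    have : n * ω + s = m := mul_left_cancel₀ h0 (by rw [hm]; ring)
    linear_combination this
  rcases mul_eq_zero.1 h with h | h <;> obtain ⟨n, hn⟩ := exists_of_qPoch_eq_zero h
  · obtain ⟨m, hm⟩ := key n z (by rw [← hn, nome, ← exp_nat_mul, ← exp_add]; push_cast; ring_nf)
    exact ⟨-n, m, by rw [hm]; push_cast; ring⟩
  · obtain ⟨m, hm⟩ := key (n + 1) (-z) (by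
      rw [← hn, nome, ← exp_nat_mul, ← exp_add, ← exp_add]; push_cast; ring_nf)
    refine ⟨n + 1, -m, ?_⟩
    push_cast at hm ⊢
    linear_combination -hm

lemma one_mem_Λ : (1 : ℂ) ∈ Λ := ⟨0, 1, by simp⟩

/-- A property of points of `ℂ` stable under translation by `±1` and `±ω` is `Λ`-invariant. -/
lemma forall_Λ_of_translate {p : ℂ → Prop} (h1 : ∀ z, p z ↔ p (z + 1)) (hω : ∀ z, p z ↔ p (z + ω))
    {z γ : ℂ} (hγ : γ ∈ Λ) : p z ↔ p (z + γ) := by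
  have h1' : ∀ (n : ℤ) z, p z ↔ p (z + n) := by
    intro n
    induction n using Int.induction_on with
    | zero => simp
    | succ n ih => intro z; rw [ih z, h1]; push_cast; rw [add_assoc]
    | pred n ih => intro z; rw [ih z, h1 (z + (-n - 1 : ℤ))]; push_cast; ring_nf
  have hω' : ∀ (n : ℤ) z, p z ↔ p (z + n * ω) := by
    intro n
    induction n using Int.induction_on with
    | zero => simp
    | succ n ih => intro z; rw [ih z, hω]; push_cast; ring_nf
    | pred n ih => intro z; rw [ih z, hω (z + (-n - 1 : ℤ) * ω)]; push_cast; ring_nf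
  obtain ⟨m, n, rfl⟩ := hγ
  rw [hω' m, h1' n, add_assoc]

lemma theta_simple_zero {γ : ℂ} (hγ : γ ∈ Λ) : theta γ = 0 ∧ deriv theta γ ≠ 0 := by
  have h0 : theta 0 = 0 ∧ deriv theta 0 ≠ 0 := by
    constructor
    · rw [theta, qPoch_eq]; simp
    · have hd := differentiable_qPoch
      have e : theta = fun z => (1 - cexp (2 * Real.pi * I * z)) *
          (qPoch (nome * cexp (2 * Real.pi * I * z)) *
            qPoch (nome * cexp (-(2 * Real.pi * I * z)))) := by
        ext z; rw [theta, qPoch_eq]; ring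
      have hl : HasDerivAt (fun z => 1 - cexp (2 * Real.pi * I * z))
          (-(2 * Real.pi * I)) 0 := by
        have := (((hasDerivAt_id' (0 : ℂ)).const_mul (2 * Real.pi * I)).cexp).const_sub 1
        simpa using this
      have hr : DifferentiableAt ℂ (fun z => qPoch (nome * cexp (2 * Real.pi * I * z)) *
            qPoch (nome * cexp (-(2 * Real.pi * I * z)))) 0 := by fun_prop
      rw [e, (hl.fun_mul hr.hasDerivAt).deriv]
      simp [qPoch_nome_ne_zero, Real.pi_ne_zero]
  have := (forall_Λ_of_translate (p := fun z => theta z = 0 ∧ deriv theta z ≠ 0) (z := 0)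
    ?_ ?_ hγ).1 h0
  · simpa using this
  · intro z
    rw [← deriv_comp_add_const]
    simp only [theta_add_one]
  · intro z
    rw [← deriv_comp_add_const]
    simp only [theta_add_ω]
    have hl : HasDerivAt (fun z => -cexp (-(2 * Real.pi * I * z)))
        (2 * Real.pi * I * cexp (-(2 * Real.pi * I * z))) z := by
      have := (((hasDerivAt_id' z).const_mul (2 * Real.pi * I)).fun_neg.cexp).fun_neg
      refine this.congr_deriv ?_
      ring
    rw [(hl.fun_mul (differentiable_theta z).hasDerivAt).deriv]
    constructor
    · rintro ⟨a, b⟩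
      simp [a, b]
    · rintro ⟨a, b⟩
      have : theta z = 0 := by simpa using a
      simpa [this] using b

lemma countable_Λ : Λ.Countable := by
  have : Λ = Set.range fun p : ℤ × ℤ => (p.1 * ω + p.2 : ℂ) := by
    ext z
    simp only [Λ, Set.mem_ofPred_eq, Set.mem_range, Prod.exists, eq_comm]
  rw [this]
  exact Set.countable_range _

/-- A continuous function annihilated by `theta (· - a)` vanishes. -/
lemma eq_zero_of_theta_mul {f : ℂ → ℂ} (hf : Continuous f) (a : ℂ)
    (h : ∀ z, theta (z - a) * f z = 0) (z : ℂ) : f z = 0 := by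
  have hc : ((fun z => z - a) ⁻¹' Λ).Countable :=
    countable_Λ.preimage (fun x y h => by simpa using h)
  have hd := hc.dense_compl ℝ
  have := hf.ext_on hd (continuous_const (y := (0 : ℂ))) fun x hx => ?_
  · exact congrFun this z
  · exact (mul_eq_zero.1 (h x)).resolve_left fun h0 => hx (mem_Λ_of_theta_eq_zero h0)

/-- A smooth function which vanishes, with all its `z̄`-derivatives, on `a + Λ` is divisible by
`theta (· - a)`. -/
lemma Smooth.exists_eq_theta_mul {f : ℂ → ℂ} (hf : Smooth f) (a : ℂ)
    (h : ∀ z, z - a ∈ Λ → ∀ k, TBG.Dbar^[k] f z = 0) :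
    ∃ g, Smooth g ∧ ∀ z, f z = theta (z - a) * g z := by
  classical
  have hlin : ∀ b, b - a ∈ Λ → ∃ g, Smooth g ∧ ∀ z, f z = (z - b) * g z :=
    fun b hb => hf.exists_eq_sub_mul b (h b hb)
  choose! G hG hGf using hlin
  have hth : Differentiable ℂ fun z => theta (z - a) := by
    have := differentiable_theta
    fun_prop
  set g : ℂ → ℂ := fun z =>
    if z - a ∈ Λ then G z z / deriv theta (z - a) else f z / theta (z - a) with hg
  refine ⟨g, contDiff_iff_contDiffAt.2 fun b => ?_, fun z => ?_⟩
  · by_cases hb : b - a ∈ Λ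
    · obtain ⟨hz, hz'⟩ := theta_simple_zero hb
      set H := dslope (fun z => theta (z - a)) b with hH
      have hHd : Differentiable ℂ H := by
        rw [← differentiableOn_univ] at hth ⊢
        exact (differentiableOn_dslope Filter.univ_mem).2 hth
      have hHb : H b = deriv theta (b - a) := by
        rw [hH, dslope_same, deriv_comp_sub_const]
      have hHb0 : H b ≠ 0 := hHb ▸ hz'
      have hHs : Smooth H := (hHd.contDiff (n := (⊤ : ℕ∞))).restrict_scalars ℝ
      have hmul : ∀ z, theta (z - a) = (z - b) * H z := by
        intro z
        have := sub_smul_dslope (fun z => theta (z - a)) b z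
        simpa [hz, eq_comm] using this
      have hev : g =ᶠ[nhds b] fun z => G b z / H z := by
        filter_upwards [hHs.continuous.continuousAt.eventually_ne hHb0] with z hz0
        by_cases hzb : z = b
        · subst hzb; simp [hg, hb, hHb]
        · have hne : z - b ≠ 0 := sub_ne_zero.2 hzb
          have : z - a ∉ Λ := fun hm => by
            have := (theta_simple_zero hm).1
            rw [hmul] at this
            exact (mul_ne_zero hne hz0) this
          simp only [hg, this, if_false]
          rw [hGf b hb z, hmul]
          field_simp
      simp only [div_eq_mul_inv] at hev
      exact ((hG b hb).contDiffAt.mul (hHs.contDiffAt.inv hHb0)).congr_of_eventuallyEq hev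
    · have hb0 : theta (b - a) ≠ 0 := fun h0 => hb (mem_Λ_of_theta_eq_zero h0)
      have hev : g =ᶠ[nhds b] fun z => f z / theta (z - a) := by
        filter_upwards [hth.continuous.continuousAt.eventually_ne hb0] with z hz0
        have : z - a ∉ Λ := fun hm => hz0 (theta_simple_zero hm).1
        simp only [hg, this, if_false]
      have hts : Smooth fun z => theta (z - a) :=
        (hth.contDiff (n := (⊤ : ℕ∞))).restrict_scalars ℝ
      simp only [div_eq_mul_inv] at hev
      exact (hf.contDiffAt.mul (hts.contDiffAt.inv hb0)).congr_of_eventuallyEq hev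
  · by_cases hz : z - a ∈ Λ
    · rw [(theta_simple_zero hz).1, zero_mul]
      exact h z hz 0
    · have : theta (z - a) ≠ 0 := fun h0 => hz (mem_Λ_of_theta_eq_zero h0)
      simp only [hg, hz, if_false]
      field_simp

lemma exists_bound_of_periodic {F : ℂ → ℝ} (hF : Continuous F)
    (hp : ∀ γ ∈ Λ, ∀ z, F (z + γ) = F z) : ∃ C, ∀ z, F z ≤ C := by
  set g : ℝ × ℝ → ℂ := fun p => p.1 * ω + p.2 with hg
  have hgc : Continuous g := by fun_prop
  have hK : IsCompact (g '' (Set.Icc (0 : ℝ) 1 ×ˢ Set.Icc (0 : ℝ) 1)) :=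
    (isCompact_Icc.prod isCompact_Icc).image hgc
  obtain ⟨C, hC⟩ := hK.bddAbove_image hF.continuousOn
  refine ⟨C, fun z => ?_⟩
  set y : ℝ := z.im / ω.im
  set x : ℝ := z.re - y * ω.re
  have hz : z = y * ω + x := by
    have := ω_im_pos.ne'
    apply Complex.ext
    · simp [x]
    · simp [y]; field_simp
  have e : F z = F (g (Int.fract y, Int.fract x)) := by
    have hy : (⌊y⌋ : ℂ) + (Int.fract y : ℝ) = y := by exact_mod_cast Int.floor_add_fract y
    have hx : (⌊x⌋ : ℂ) + (Int.fract x : ℝ) = x := by exact_mod_cast Int.floor_add_fract x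
    rw [← hp (⌊y⌋ * ω + ⌊x⌋) ⟨_, _, rfl⟩ (g _)]
    congr 1
    linear_combination hz - ω * hy - hx
  rw [e]
  exact hC ⟨_, ⟨_, ⟨⟨Int.fract_nonneg _, (Int.fract_lt_one _).le⟩,
    ⟨Int.fract_nonneg _, (Int.fract_lt_one _).le⟩⟩, rfl⟩, rfl⟩

lemma smooth_exp (a b : ℂ) : Smooth fun z => cexp (a * z + b * (starRingEnd ℂ) z) := by
  have h : Smooth fun z : ℂ => (starRingEnd ℂ) z := conjCLE.contDiff
  exact ((contDiff_const.mul contDiff_id).add (contDiff_const.mul h)).cexp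

lemma Dbar_exp (a b z : ℂ) : Dbar (fun z => cexp (a * z + b * (starRingEnd ℂ) z)) z =
    2 / I * b * cexp (a * z + b * (starRingEnd ℂ) z) := by
  have h1 : HasFDerivAt (fun z : ℂ => a * z) (a • ContinuousLinearMap.id ℝ ℂ) z :=
    (hasFDerivAt_id z).const_mul a
  have h2 : HasFDerivAt (fun z : ℂ => b * (starRingEnd ℂ) z) (b • (conjCLE : ℂ →L[ℝ] ℂ)) z :=
    (conjCLE.hasFDerivAt (x := z)).const_mul b
  refine (dz_Dbar_of_hasFDerivAt (a := a * cexp (a * z + b * (starRingEnd ℂ) z)) ?_).2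
  refine (h1.add h2).cexp.congr_fderiv ?_
  ext v
  simp
  field_simp
  rw [I_sq]
  ring

lemma norm_exp_character (s z : ℂ) :
    ‖cexp (I / 2 * (starRingEnd ℂ) s * z + I / 2 * s * (starRingEnd ℂ) z)‖ = 1 := by
  rw [norm_exp, Real.exp_eq_one_iff]
  simp

lemma Smooth.differentiable_complex {f : ℂ → ℂ} (hf : Smooth f) (h : ∀ z, TBG.Dbar f z = 0) :
    Differentiable ℂ f := by
  intro z
  have h1 := hasFDerivAt_dz_Dbar hf.differentiable z
  rw [h z] at h1
  exact (hasFDerivAt_of_restrictScalars ℝ (f' := TBG.dz f z • ContinuousLinearMap.id ℂ ℂ) h1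
    (by ext; simp)).differentiableAt

/-- A `Λ`-periodic solution of `2 D_z̄ W + s W = 0` is a multiple of a character. -/
lemma Smooth.eq_const_mul_character {W : ℂ → ℂ} {s : ℂ} (hW : Smooth W)
    (hD : ∀ z, TBG.Dbar W z = -s * W z) (hp : ∀ γ ∈ Λ, ∀ z, W (z + γ) = W z) :
    ∃ C, ∀ z, cexp (I / 2 * (starRingEnd ℂ) s * z + I / 2 * s * (starRingEnd ℂ) z) * W z = C := by
  have he := smooth_exp (I / 2 * (starRingEnd ℂ) s) (I / 2 * s)
  have hH := he.mul hW
  have hd := Smooth.differentiable_complex hH fun z => by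
    rw [Dbar_mul he.differentiable hW.differentiable, Dbar_exp, hD]
    field_simp
    ring
  obtain ⟨C, hC⟩ := exists_bound_of_periodic hW.continuous.norm fun γ hγ z => by rw [hp γ hγ]
  refine ⟨_, fun z => hd.apply_eq_apply_of_bounded ?_ z 0⟩
  refine isBounded_iff_forall_norm_le.2 ⟨C, ?_⟩
  rintro _ ⟨z, rfl⟩
  simpa only [norm_mul, norm_exp_character, one_mul] using hC z

section Kernel

variable {Up Um : ℂ → ℂ} {α k l : ℂ} {u v : ℂ → ℂ × ℂ}

lemma InKer.smooth_fst (hu : InKer Up Um α k u) : Smooth fun z => (u z).1 := hu.1.fst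

lemma InKer.smooth_snd (hu : InKer Up Um α k u) : Smooth fun z => (u z).2 := hu.1.snd

lemma InKer.Dbar_fst (hu : InKer Up Um α k u) (z : ℂ) :
    Dbar (fun w => (u w).1) z = -(k * (u z).1 + α * Up z * (u z).2) := by
  linear_combination hu.2.1 z

lemma InKer.Dbar_snd (hu : InKer Up Um α k u) (z : ℂ) :
    Dbar (fun w => (u w).2) z = -(k * (u z).2 + α * Um z * (u z).1) := by
  linear_combination hu.2.2.1 z

/-- The Wronskian of two functions with values in `ℂ²`. -/
def wronskian (u v : ℂ → ℂ × ℂ) (z : ℂ) : ℂ := (u z).1 * (v z).2 - (u z).2 * (v z).1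

lemma InKer.wronskian_eq (hu : InKer Up Um α k u) (hv : InKer Up Um α l v) :
    (∀ γ ∈ Λ, ∀ z, wronskian u v (z + γ) = wronskian u v z) ∧
    ∃ C, ∀ z, cexp (I / 2 * (starRingEnd ℂ) (k + l) * z + I / 2 * (k + l) * (starRingEnd ℂ) z) *
      wronskian u v z = C := by
  have hper : ∀ γ ∈ Λ, ∀ z, wronskian u v (z + γ) = wronskian u v z := by
    intro γ hγ z
    have h : cexp (-I * (pair γ K : ℂ)) * cexp (I * (pair γ K : ℂ)) = 1 := by
      rw [← exp_add]; simp
    rw [wronskian, hu.2.2.2.1 γ hγ, hu.2.2.2.2 γ hγ, hv.2.2.2.1 γ hγ, hv.2.2.2.2 γ hγ, wronskian]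
    linear_combination ((u z).1 * (v z).2 - (u z).2 * (v z).1) * h
  refine ⟨hper, Smooth.eq_const_mul_character
    ((hu.smooth_fst.mul hv.smooth_snd).sub (hu.smooth_snd.mul hv.smooth_fst)) (fun z => ?_) hper⟩
  have h1 := hu.smooth_fst.differentiable
  have h2 := hu.smooth_snd.differentiable
  have h3 := hv.smooth_fst.differentiable
  have h4 := hv.smooth_snd.differentiable
  unfold wronskian
  rw [Dbar_sub (h1.fun_mul h4) (h2.fun_mul h3), Dbar_mul h1 h4, Dbar_mul h2 h3, hu.Dbar_fst, hu.Dbar_snd,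
    hv.Dbar_fst, hv.Dbar_snd]
  ring

lemma InKer.wronskian_eq_zero_of_eq_zero (hu : InKer Up Um α k u) (hv : InKer Up Um α l v) {a : ℂ}
    (h : wronskian u v a = 0) (z : ℂ) : wronskian u v z = 0 := by
  obtain ⟨C, hC⟩ := (hu.wronskian_eq hv).2
  have hC0 : C = 0 := by rw [← hC a, h, mul_zero]
  exact (mul_eq_zero.1 ((hC z).trans hC0)).resolve_left (exp_ne_zero _)

lemma InKer.wronskian_pi_sub (hu : InKer Up Um α k u) (hv : InKer Up Um α (Real.pi - k) v) (z : ℂ) :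
    wronskian u v z = 0 := by
  obtain ⟨hp, C, hC⟩ := hu.wronskian_eq hv
  refine hu.wronskian_eq_zero_of_eq_zero hv (a := 0) ?_ z
  have h0 := hC 0
  have h1 := hC (0 + 1)
  rw [hp 1 one_mem_Λ, ← h0] at h1
  have e : I / 2 * Real.pi + I / 2 * Real.pi = Real.pi * I := by ring
  simp [e, exp_pi_mul_I] at h1
  linear_combination (-1 / 2 : ℂ) * h1

/-- For magic `α`, elements of `Ker(α,k)` are pointwise parallel. -/
lemma IsMagic.wronskian_eq_zero (hm : IsMagic Up Um α) (hu : InKer Up Um α k u)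
    (hv : InKer Up Um α k v) (z : ℂ) : wronskian u v z = 0 := by
  obtain ⟨w, hw, hw0⟩ := hm (Real.pi - k)
  obtain ⟨a, ha⟩ := Function.ne_iff.1 hw0
  have h1 := hu.wronskian_pi_sub hw a
  have h2 := hv.wronskian_pi_sub hw a
  refine hu.wronskian_eq_zero_of_eq_zero hv (a := a) ?_ z
  unfold wronskian at *
  by_cases h : (w a).1 = 0
  · have h' : (w a).2 ≠ 0 := fun h' => ha (Prod.ext h h')
    refine (mul_eq_zero.1 (?_ : (w a).2 * _ = 0)).resolve_left h'
    linear_combination (v a).2 * h1 - (u a).2 * h2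
  · refine (mul_eq_zero.1 (?_ : (w a).1 * _ = 0)).resolve_left h
    linear_combination (v a).1 * h1 - (u a).1 * h2

/-- `Ker(α,k)` as a subspace. -/
def kerSub (Up Um : ℂ → ℂ) (α k : ℂ) : Submodule ℂ (ℂ → ℂ × ℂ) where
  carrier := kerSet Up Um α k
  zero_mem' := by
    have h : Dbar (fun _ => (0 : ℂ)) = 0 := by
      ext z
      exact Dbar_holo (by fun_prop) z
    refine ⟨contDiff_const, fun z => ?_, fun z => ?_, fun γ _ z => ?_, fun γ _ z => ?_⟩ <;>
    simp [h]
  add_mem' := by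
    rintro u v hu hv
    refine ⟨hu.1.add hv.1, fun z => ?_, fun z => ?_, fun γ hγ z => ?_, fun γ hγ z => ?_⟩
    · simp only [Pi.add_apply, Prod.fst_add, Prod.snd_add]
      rw [Dbar_add hu.smooth_fst.differentiable hv.smooth_fst.differentiable]
      linear_combination hu.2.1 z + hv.2.1 z
    · simp only [Pi.add_apply, Prod.fst_add, Prod.snd_add]
      rw [Dbar_add hu.smooth_snd.differentiable hv.smooth_snd.differentiable]
      linear_combination hu.2.2.1 z + hv.2.2.1 z
    · simp only [Pi.add_apply, Prod.fst_add]
      linear_combination hu.2.2.2.1 γ hγ z + hv.2.2.2.1 γ hγ z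
    · simp only [Pi.add_apply, Prod.snd_add]
      linear_combination hu.2.2.2.2 γ hγ z + hv.2.2.2.2 γ hγ z
  smul_mem' := by
    rintro c u hu
    refine ⟨contDiff_const.smul hu.1, fun z => ?_, fun z => ?_, fun γ hγ z => ?_,
      fun γ hγ z => ?_⟩ <;> simp only [Pi.smul_apply, Prod.smul_fst, Prod.smul_snd, smul_eq_mul]
    · rw [Dbar_const_mul hu.smooth_fst.differentiable]
      linear_combination c * hu.2.1 z
    · rw [Dbar_const_mul hu.smooth_snd.differentiable]
      linear_combination c * hu.2.2.1 z
    · linear_combination c * hu.2.2.2.1 γ hγ z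
    · linear_combination c * hu.2.2.2.2 γ hγ z

lemma kerDim_eq_finrank (Up Um : ℂ → ℂ) (α k : ℂ) :
    kerDim Up Um α k = Module.finrank ℂ (kerSub Up Um α k) := by
  rw [kerDim, show kerSet Up Um α k = kerSub Up Um α k from rfl, Submodule.span_eq]

/-- Evaluation at a point on `Ker(α,k)`. -/
def kerEval (Up Um : ℂ → ℂ) (α k z : ℂ) : kerSub Up Um α k →ₗ[ℂ] ℂ × ℂ :=
  (LinearMap.proj z).comp (kerSub Up Um α k).subtype

lemma IsMagic.finrank_range_kerEval_le (hm : IsMagic Up Um α) (k z : ℂ) :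
    Module.finrank ℂ (LinearMap.range (kerEval Up Um α k z)) ≤ 1 := by
  have hne : LinearMap.range (kerEval Up Um α k z) ≠ ⊤ := by
    intro h
    obtain ⟨u, hu⟩ := LinearMap.range_eq_top.1 h (1, 0)
    obtain ⟨v, hv⟩ := LinearMap.range_eq_top.1 h (0, 1)
    have hu' : u.1 z = (1, 0) := hu
    have hv' : v.1 z = (0, 1) := hv
    have := hm.wronskian_eq_zero u.2 v.2 z
    simp [wronskian, hu', hv'] at this
  have := Submodule.finrank_lt hne
  simp only [Module.finrank_prod, Module.finrank_self] at this
  lia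

lemma InKer.exists_iterate_Dbar (hUp : Smooth Up) (hUm : Smooth Um) (hu : InKer Up Um α k u)
    {f a b : ℂ → ℂ} (ha : Smooth a) (hb : Smooth b) (hf : f = fun z => a z * (u z).1 + b z * (u z).2)
    (n : ℕ) : ∃ a' b', Smooth a' ∧ Smooth b' ∧
      Dbar^[n] f = fun z => a' z * (u z).1 + b' z * (u z).2 := by
  induction n with
  | zero => exact ⟨a, b, ha, hb, hf⟩
  | succ n ih =>
    obtain ⟨a, b, ha, hb, h⟩ := ih
    refine ⟨fun z => Dbar a z - k * a z - α * Um z * b z, fun z => Dbar b z - k * b z - α * Up z * a z,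
      (ha.Dbar.sub (contDiff_const.mul ha)).sub ((contDiff_const.mul hUm).mul hb),
      (hb.Dbar.sub (contDiff_const.mul hb)).sub ((contDiff_const.mul hUp).mul ha), ?_⟩
    ext z
    have h1 := hu.smooth_fst.differentiable
    have h2 := hu.smooth_snd.differentiable
    rw [Function.iterate_succ_apply', h, Dbar_add (ha.differentiable.fun_mul h1)
      (hb.differentiable.fun_mul h2), Dbar_mul ha.differentiable h1, Dbar_mul hb.differentiable h2,
      hu.Dbar_fst, hu.Dbar_snd]
    ring

lemma InKer.eq_zero_of_sub_mem (hu : InKer Up Um α k u) {a z : ℂ} (ha : u a = 0) (hz : z - a ∈ Λ) :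
    u z = 0 := by
  have h1 := hu.2.2.2.1 _ hz a
  have h2 := hu.2.2.2.2 _ hz a
  simp only [ha, add_sub_cancel, Prod.fst_zero, Prod.snd_zero, mul_zero] at h1 h2
  exact Prod.ext h1 h2

lemma InKer.exists_eq_theta_smul (hUp : Smooth Up) (hUm : Smooth Um) (hu : InKer Up Um α k u)
    {a : ℂ} (ha : u a = 0) :
    ∃ w : ℂ → ℂ × ℂ, ContDiff ℝ (⊤ : ℕ∞) w ∧ ∀ z, u z = theta (z - a) • w z := by
  obtain ⟨w₁, h₁, e₁⟩ := hu.smooth_fst.exists_eq_theta_mul a fun z hz n => by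
    obtain ⟨a', b', -, -, h⟩ := hu.exists_iterate_Dbar hUp hUm (a := 1) (b := 0)
      (f := fun z => (u z).1) contDiff_const contDiff_const (by simp) n
    simp [h, hu.eq_zero_of_sub_mem ha hz]
  obtain ⟨w₂, h₂, e₂⟩ := hu.smooth_snd.exists_eq_theta_mul a fun z hz n => by
    obtain ⟨a', b', -, -, h⟩ := hu.exists_iterate_Dbar hUp hUm (a := 0) (b := 1)
      (f := fun z => (u z).2) contDiff_const contDiff_const (by simp) n
    simp [h, hu.eq_zero_of_sub_mem ha hz]
  exact ⟨fun z => (w₁ z, w₂ z), h₁.prodMk h₂, fun z => Prod.ext (e₁ z) (e₂ z)⟩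

/-- The displacement of the zero of the theta quotient with multiplier `s`. -/
def thetaShift (s : ℂ) : ℂ := s * ((starRingEnd ℂ) ω - ω) / (4 * Real.pi)

/-- The numerator of the theta quotient with `2 D_z̄ F = s F` and a simple pole at `a`. -/
def numer (s a z : ℂ) : ℂ :=
  cexp (-(I / 2 * s) * z + I / 2 * s * (starRingEnd ℂ) z) * theta (z - (a - thetaShift s))

lemma smooth_theta_sub (a : ℂ) : Smooth fun z => theta (z - a) :=
  ((differentiable_theta.comp (differentiable_id.sub_const a)).contDiff
    (n := (⊤ : ℕ∞))).restrict_scalars ℝ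

lemma smooth_numer (s a : ℂ) : Smooth (numer s a) :=
  (smooth_exp _ _).mul (smooth_theta_sub _)

lemma Dbar_theta_sub (a z : ℂ) : Dbar (fun z => theta (z - a)) z = 0 :=
  Dbar_holo (differentiable_theta.comp (differentiable_id.sub_const a)) z

lemma Dbar_numer (s a z : ℂ) : Dbar (numer s a) z = s * numer s a z := by
  unfold numer
  rw [Dbar_mul (smooth_exp _ _).differentiable (smooth_theta_sub _).differentiable, Dbar_exp,
    Dbar_theta_sub]
  field_simp
  ring

lemma numer_div_theta_periodic (s a : ℂ) {γ : ℂ} (hγ : γ ∈ Λ) (z : ℂ) :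
    numer s a (z + γ) / theta (z + γ - a) = numer s a z / theta (z - a) := by
  refine ((forall_Λ_of_translate
    (p := fun x => numer s a x / theta (x - a) = numer s a z / theta (z - a)) ?_ ?_ hγ).1 rfl)
  · intro x
    have e : numer s a (x + 1) = numer s a x := by
      unfold numer
      rw [add_sub_right_comm, theta_add_one]
      congr 2
      simp
      ring
    rw [add_sub_right_comm, theta_add_one, e]
  · intro x
    have e : numer s a (x + ω) = -cexp (-(2 * Real.pi * I * (x - a))) * numer s a x := by
      have hpi : (Real.pi : ℂ) ≠ 0 := by exact_mod_cast Real.pi_ne_zero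
      have hx : cexp (-(I / 2 * s) * (x + ω) + I / 2 * s * (starRingEnd ℂ) (x + ω)) *
          cexp (-(2 * Real.pi * I * (x - (a - thetaShift s)))) =
          cexp (-(2 * Real.pi * I * (x - a))) *
          cexp (-(I / 2 * s) * x + I / 2 * s * (starRingEnd ℂ) x) := by
        rw [← exp_add, ← exp_add]
        congr 1
        simp only [thetaShift, map_add]
        field_simp
        ring
      unfold numer
      rw [add_sub_right_comm, theta_add_ω]
      linear_combination (-theta (x - (a - thetaShift s))) * hx
    rw [add_sub_right_comm, theta_add_ω, e, mul_div_mul_left _ _ (neg_ne_zero.2 (exp_ne_zero _))]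

/-- Multiplication by a theta quotient maps elements of `Ker(α,k)` vanishing at `a` into
`Ker(α,l)`. -/
lemma InKer.exists_transfer (hUp : Smooth Up) (hUm : Smooth Um) (hu : InKer Up Um α k u) (l : ℂ)
    {a : ℂ} (ha : u a = 0) : ∃ v, InKer Up Um α l v ∧ v (a - thetaShift (k - l)) = 0 ∧
      ∀ z, theta (z - a) • v z = numer (k - l) a z • u z := by
  obtain ⟨w, hw, huw⟩ := hu.exists_eq_theta_smul hUp hUm ha
  set E := numer (k - l) a with hE
  have hEs : Smooth E := smooth_numer _ _
  have hw1 : Smooth fun z => (w z).1 := hw.fst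
  have hw2 : Smooth fun z => (w z).2 := hw.snd
  have hv : ContDiff ℝ (⊤ : ℕ∞) fun z => E z • w z := hEs.smul hw
  have hrel : ∀ z, theta (z - a) • E z • w z = E z • u z := fun z => by
    rw [huw, smul_comm]
  have hth := (smooth_theta_sub a).differentiable
  have huw1 : (fun z => (u z).1) = fun z => theta (z - a) * (w z).1 := by ext z; rw [huw]; rfl
  have huw2 : (fun z => (u z).2) = fun z => theta (z - a) * (w z).2 := by ext z; rw [huw]; rfl
  have hper : ∀ γ ∈ Λ, ∀ z, theta (z - a) ≠ 0 →
      E (z + γ) • w (z + γ) = (E z / theta (z - a)) • u (z + γ) := by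
    intro γ hγ z hz
    have hz' : theta (z + γ - a) ≠ 0 := by
      intro h0
      have := (forall_Λ_of_translate (p := fun x => theta x ≠ 0) (fun x => by rw [theta_add_one])
        (fun x => by rw [theta_add_ω]; simp) hγ).1 hz
      exact this (by rwa [sub_add_eq_add_sub])
    rw [← numer_div_theta_periodic _ _ hγ, ← hE, huw (z + γ), smul_smul, div_mul_cancel₀ _ hz']
  have hper0 : ∀ z, theta (z - a) ≠ 0 → E z • w z = (E z / theta (z - a)) • u z := fun z hz => by
    simpa using hper 0 ⟨0, 0, by simp⟩ z hz
  refine ⟨fun z => E z • w z, ⟨hv, ?_, ?_, ?_, ?_⟩, ?_, hrel⟩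
  · have hc1 : Continuous fun z => Dbar (fun z => (w z).1) z + k * (w z).1 + α * Up z * (w z).2 :=
      (hw1.Dbar.continuous.add (continuous_const.mul hw1.continuous)).add
        ((continuous_const.mul hUp.continuous).mul hw2.continuous)
    have h := eq_zero_of_theta_mul hc1 a fun z => by
      have := hu.2.1 z
      rw [huw1, Dbar_mul hth hw1.differentiable, Dbar_theta_sub] at this
      simp only [huw z, Prod.smul_fst, Prod.smul_snd, smul_eq_mul] at this
      linear_combination this
    intro z
    simp only [Prod.smul_fst, Prod.smul_snd, smul_eq_mul]
    rw [Dbar_mul hEs.differentiable hw1.differentiable, Dbar_numer]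
    linear_combination E z * h z
  · have hc1 : Continuous fun z => Dbar (fun z => (w z).2) z + k * (w z).2 + α * Um z * (w z).1 :=
      (hw2.Dbar.continuous.add (continuous_const.mul hw2.continuous)).add
        ((continuous_const.mul hUm.continuous).mul hw1.continuous)
    have h := eq_zero_of_theta_mul hc1 a fun z => by
      have := hu.2.2.1 z
      rw [huw2, Dbar_mul hth hw2.differentiable, Dbar_theta_sub] at this
      simp only [huw z, Prod.smul_fst, Prod.smul_snd, smul_eq_mul] at this
      linear_combination this
    intro z
    simp only [Prod.smul_fst, Prod.smul_snd, smul_eq_mul]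
    rw [Dbar_mul hEs.differentiable hw2.differentiable, Dbar_numer]
    linear_combination E z * h z
  · intro γ hγ z
    refine sub_eq_zero.1 (eq_zero_of_theta_mul (f := fun z => (E (z + γ) • w (z + γ)).1 -
      cexp (-I * (pair γ K : ℂ)) * (E z • w z).1) ?_ a (fun z => ?_) z)
    · have := hv.continuous
      fun_prop
    · by_cases hz : theta (z - a) = 0
      · rw [hz, zero_mul]
      · rw [hper γ hγ z hz, hper0 z hz, Prod.smul_fst, Prod.smul_fst, hu.2.2.2.1 γ hγ, smul_eq_mul,
          smul_eq_mul]
        ring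
  · intro γ hγ z
    refine sub_eq_zero.1 (eq_zero_of_theta_mul (f := fun z => (E (z + γ) • w (z + γ)).2 -
      cexp (I * (pair γ K : ℂ)) * (E z • w z).2) ?_ a (fun z => ?_) z)
    · have := hv.continuous
      fun_prop
    · by_cases hz : theta (z - a) = 0
      · rw [hz, zero_mul]
      · rw [hper γ hγ z hz, hper0 z hz, Prod.smul_snd, Prod.smul_snd, hu.2.2.2.2 γ hγ, smul_eq_mul,
          smul_eq_mul]
        ring
  · have h0 : E (a - thetaShift (k - l)) = 0 := by
      rw [hE, numer, sub_self, (theta_simple_zero ⟨0, 0, by simp⟩).1, mul_zero]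
    simp only [h0, zero_smul]

lemma eq_zero_of_theta_smul {f : ℂ → ℂ × ℂ} (hf : Continuous f) (a : ℂ)
    (h : ∀ z, theta (z - a) • f z = 0) : f = 0 := by
  ext z
  · exact eq_zero_of_theta_mul hf.fst a (fun z => congrArg Prod.fst (h z)) z
  · exact eq_zero_of_theta_mul hf.snd a (fun z => congrArg Prod.snd (h z)) z

lemma exists_injective_transfer (hUp : Smooth Up) (hUm : Smooth Um) (α k l a : ℂ) :
    ∃ Φ : LinearMap.ker (kerEval Up Um α k a) →ₗ[ℂ]
      LinearMap.ker (kerEval Up Um α l (a - thetaShift (k - l))), Function.Injective Φ := by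
  have key : ∀ u : LinearMap.ker (kerEval Up Um α k a),
      ∃ v : LinearMap.ker (kerEval Up Um α l (a - thetaShift (k - l))),
        ∀ z, theta (z - a) • v.1.1 z = numer (k - l) a z • u.1.1 z := by
    rintro ⟨⟨u, hu⟩, hu0⟩
    obtain ⟨v, hv, hv0, h⟩ := InKer.exists_transfer hUp hUm hu l hu0
    exact ⟨⟨⟨v, hv⟩, hv0⟩, h⟩
  choose Φ hΦ using key
  have uniq : ∀ v w : LinearMap.ker (kerEval Up Um α l (a - thetaShift (k - l))),
      (∀ z, theta (z - a) • v.1.1 z = theta (z - a) • w.1.1 z) → v = w := by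
    intro v w h
    have hv : Continuous v.1.1 := v.1.2.1.continuous
    have hw : Continuous w.1.1 := w.1.2.1.continuous
    refine Subtype.ext (Subtype.ext (sub_eq_zero.1 (eq_zero_of_theta_smul (hv.sub hw) a fun z => ?_)))
    rw [Pi.sub_apply, smul_sub, h, sub_self]
  refine ⟨⟨⟨Φ, fun u v => uniq _ _ fun z => ?_⟩, fun c u => uniq _ _ fun z => ?_⟩, ?_⟩
  · simp [smul_add, hΦ]
  · simp [smul_comm _ c, hΦ]
  · refine (injective_iff_map_eq_zero _).2 fun u hu => ?_
    have hc : Continuous u.1.1 := u.1.2.1.continuous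
    refine Subtype.ext (Subtype.ext (eq_zero_of_theta_smul hc (a - thetaShift (k - l)) fun z => ?_))
    have h := hΦ u z
    have hu : Φ u = 0 := hu
    rw [hu] at h
    have h' : numer (k - l) a z • u.1.1 z = 0 := by rw [← h]; simp
    rw [numer, mul_smul] at h'
    exact (smul_eq_zero.1 h').resolve_left (exp_ne_zero _)

/-- For magic `α`, the dimension of `Ker(α,k)` is bounded by that of `Ker(α,l)`. -/
lemma IsMagic.finrank_kerSub_le (hUp : Smooth Up) (hUm : Smooth Um) (hm : IsMagic Up Um α)
    (k l : ℂ) [FiniteDimensional ℂ (kerSub Up Um α l)] :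
    FiniteDimensional ℂ (kerSub Up Um α k) ∧
      Module.finrank ℂ (kerSub Up Um α k) ≤ Module.finrank ℂ (kerSub Up Um α l) := by
  obtain ⟨v, hv, hv0⟩ := hm l
  obtain ⟨b, hb⟩ := Function.ne_iff.1 hv0
  let f := kerEval Up Um α k (b + thetaShift (k - l))
  have ht := exists_injective_transfer hUp hUm α k l (b + thetaShift (k - l))
  rw [add_sub_cancel_right] at ht
  obtain ⟨Φ, hΦ⟩ : ∃ Φ : LinearMap.ker f →ₗ[ℂ] LinearMap.ker (kerEval Up Um α l b),
    Function.Injective Φ := ht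
  have hW : Module.Finite ℂ (LinearMap.ker f) := Module.Finite.of_injective Φ hΦ
  have hV : Module.Finite ℂ (kerSub Up Um α k) := by
    have : Module.Finite ℂ (kerSub Up Um α k ⧸ LinearMap.ker f) :=
      Module.Finite.equiv f.quotKerEquivRange.symm
    exact Module.Finite.of_submodule_quotient (LinearMap.ker f)
  refine ⟨hV, ?_⟩
  have hne : LinearMap.ker (kerEval Up Um α l b) ≠ ⊤ := by
    intro h
    have hvb : (⟨v, hv⟩ : kerSub Up Um α l) ∈ LinearMap.ker (kerEval Up Um α l b) := by
      rw [h]; trivial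
    exact hb hvb
  have h1 := LinearMap.finrank_le_finrank_of_injective hΦ
  have h2 := Submodule.finrank_lt hne
  have h3 := f.finrank_range_add_finrank_ker
  have h4 : Module.finrank ℂ (LinearMap.range f) ≤ 1 := hm.finrank_range_kerEval_le k _
  lia

end Kernel

/-- **spectral gap for two-fold degenerate flat bands.**
For a magic parameter `α`, the kernel is two-dimensional for every quasi-momentum iff
it is two-dimensional at one quasi-momentum. -/
theorem spectral_gap (Up Um : ℂ → ℂ)
    (hUps : ContDiff ℝ (⊤ : ℕ∞) Up) (hUms : ContDiff ℝ (⊤ : ℕ∞) Um)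
    (hUpT : ∀ γ ∈ Λ, ∀ z : ℂ, Up (z + γ) = Complex.exp (Complex.I * (pair γ K : ℂ)) * Up z)
    (hUmT : ∀ γ ∈ Λ, ∀ z : ℂ, Um (z + γ) = Complex.exp (-Complex.I * (pair γ K : ℂ)) * Um z)
    (hUpR : ∀ z : ℂ, Up (ω * z) = ω * Up z) (hUmR : ∀ z : ℂ, Um (ω * z) = ω * Um z)
    (α : ℂ) (hmagic : IsMagic Up Um α) :
    (∀ k : ℂ, kerDim Up Um α k = 2) ↔ (∃ p : ℂ, kerDim Up Um α p = 2) := by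
  refine ⟨fun h => ⟨0, h 0⟩, ?_⟩
  rintro ⟨p, hp⟩ k
  rw [kerDim_eq_finrank] at hp ⊢
  have : FiniteDimensional ℂ (kerSub Up Um α p) := FiniteDimensional.of_finrank_pos (by lia)
  obtain ⟨_, h⟩ := hmagic.finrank_kerSub_le hUps hUms k p
  have h' := (hmagic.finrank_kerSub_le hUps hUms p k).2
  lia

end TBG
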